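/- Let s > 0 be real and set α := 1/2 + i·s. For t < 0 define w(t) := (1−t)^{−α}·F(α, α; 1; t/(t−1)) and w⁺(t) := (1−t)^{α−1}·F(1−α, 1−α; 2−2α; 1/(1−t)). Then the reduced Wronskian t(1−t)·( w'(t)·w⁺(t) − w(t)·(w⁺)'(t) ) is constant on (−∞, 0) and equals Γ(2−2α)/Γ(1−α)². -/

import Mathlib

/-- The Gauss hypergeometric function F(a,b;c;x), defined for real x with |x| < 1 by its
power series, with Pochhammer symbols (a)_k = a(a+1)⋯(a+k−1). -/
noncomputable def hypF (a b c : ℂ) (x : ℝ) : ℂ :=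
  ∑' k : ℕ, ((ascPochhammer ℂ k).eval a * (ascPochhammer ℂ k).eval b /
    ((ascPochhammer ℂ k).eval c * (Nat.factorial k : ℂ))) * (x : ℂ) ^ k

open Filter Topology

/-- Power series with coefficients `u`. -/
noncomputable def psum (u : ℕ → ℂ) (x : ℝ) : ℂ := ∑' k : ℕ, u k * (x : ℂ) ^ k

/-- Radius of convergence at least one. -/
def SubE (u : ℕ → ℂ) : Prop := ∀ r : ℝ, 0 < r → r < 1 → ∃ C : ℝ, ∀ k, ‖u k‖ * r ^ k ≤ C

/-- Coefficients of the derivative. -/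
def dser (u : ℕ → ℂ) (k : ℕ) : ℂ := ((k : ℂ) + 1) * u (k + 1)

lemma SubE.summable {u : ℕ → ℂ} (h : SubE u) {r : ℝ} (h0 : 0 ≤ r) (h1 : r < 1) :
    Summable (fun k => ‖u k‖ * r ^ k) := by
  obtain ⟨ρ, hρ, hρ1⟩ := exists_between h1
  have hρ0 : 0 < ρ := h0.trans_lt hρ
  obtain ⟨C, hC⟩ := h ρ hρ0 hρ1
  refine Summable.of_nonneg_of_le (fun k => by positivity) (fun k => ?_)
    ((summable_geometric_of_lt_one (r := r / ρ) (by positivity)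
      (by rwa [div_lt_one hρ0])).mul_left C)
  calc ‖u k‖ * r ^ k = ‖u k‖ * ρ ^ k * (r / ρ) ^ k := by
        rw [div_pow]; field_simp
    _ ≤ _ := by gcongr; exact hC k

lemma SubE.summable' {u : ℕ → ℂ} (h : SubE u) {x : ℝ} (hx : |x| < 1) :
    Summable (fun k => u k * (x : ℂ) ^ k) := by
  refine Summable.of_norm ?_
  simpa using h.summable (abs_nonneg x) hx

lemma SubE.dser {u : ℕ → ℂ} (h : SubE u) : SubE (dser u) := by
  intro r h0 h1
  obtain ⟨ρ, hρ, hρ1⟩ := exists_between h1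
  have hρ0 : 0 < ρ := h0.trans hρ
  obtain ⟨C, hC⟩ := h ρ hρ0 hρ1
  have hlim : Tendsto (fun n : ℕ => (n : ℝ) * (r / ρ) ^ n) atTop (𝓝 0) :=
    tendsto_self_mul_const_pow_of_lt_one (by positivity) (by rwa [div_lt_one hρ0])
  obtain ⟨B, hB⟩ := hlim.bddAbove_range
  refine ⟨C * B / r, fun k => ?_⟩
  have hB' : ((k + 1 : ℕ) : ℝ) * (r / ρ) ^ (k + 1) ≤ B := hB ⟨k + 1, rfl⟩
  have hn : ‖((k : ℂ) + 1)‖ = (k : ℝ) + 1 := by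
    have : ((k : ℂ) + 1) = (((k : ℝ) + 1 : ℝ) : ℂ) := by push_cast; rfl
    rw [this, Complex.norm_real, Real.norm_of_nonneg (by positivity)]
  have hC0 : 0 ≤ C := le_trans (by positivity) (hC 0)
  calc ‖_root_.dser u k‖ * r ^ k
      = (‖u (k + 1)‖ * ρ ^ (k + 1)) * (((k + 1 : ℕ) : ℝ) * (r / ρ) ^ (k + 1)) / r := by
        rw [_root_.dser, norm_mul, hn, div_pow]; push_cast; field_simp; ring
    _ ≤ C * B / r := by
        gcongr
        exact hC _

lemma psum_hasDerivAt {u : ℕ → ℂ} (h : SubE u) {x : ℝ} (hx : |x| < 1) :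
    HasDerivAt (psum u) (psum (dser u) x) x := by
  obtain ⟨r, hr, hr1⟩ := exists_between hx
  have hr0 : 0 < r := (abs_nonneg x).trans_lt hr
  have hs := h.dser.summable hr0.le hr1
  have key : HasDerivAt (fun z : ℝ => ∑' n : ℕ, u n * (z : ℂ) ^ n)
      (∑' n : ℕ, u n * ((n : ℂ) * (x : ℂ) ^ (n - 1))) x := by
    refine hasDerivAt_tsum_of_isPreconnected
      (u := fun n => ‖u n‖ * ((n : ℝ) * r ^ (n - 1)))
      (g' := fun n (y : ℝ) => u n * ((n : ℂ) * (y : ℂ) ^ (n - 1)))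
      (t := Set.Ioo (-r) r) (y₀ := (0 : ℝ)) ?_ isOpen_Ioo
      isPreconnected_Ioo ?_ ?_ ?_ ?_ ?_
    · rw [← summable_nat_add_iff 1]
      refine hs.congr (fun k => ?_)
      have hn : ‖((k : ℂ) + 1)‖ = (k : ℝ) + 1 := by
        have : ((k : ℂ) + 1) = (((k : ℝ) + 1 : ℝ) : ℂ) := by push_cast; rfl
        rw [this, Complex.norm_real, Real.norm_of_nonneg (by positivity)]
      rw [dser, norm_mul, hn, Nat.add_sub_cancel]; push_cast; ring
    · intro n y hy
      have := ((hasDerivAt_pow n (y : ℂ)).comp_ofReal).const_mul (u n)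
      exact this
    · intro n y hy
      have : |y| ≤ r := abs_le.2 ⟨hy.1.le, hy.2.le⟩
      simp only [norm_mul, norm_pow, Complex.norm_real, Real.norm_eq_abs, Complex.norm_natCast]
      gcongr
    · exact ⟨by linarith, hr0⟩
    · exact h.summable' (by simp)
    · exact abs_lt.1 hr
  have e : psum (dser u) x = ∑' n : ℕ, u n * ((n : ℂ) * (x : ℂ) ^ (n - 1)) := by
    have hsum : Summable (fun n : ℕ => u n * ((n : ℂ) * (x : ℂ) ^ (n - 1))) := by
      rw [← summable_nat_add_iff 1]
      refine (h.dser.summable' hx).congr (fun k => ?_)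
      simp only [dser, Nat.add_sub_cancel]; push_cast; ring
    rw [hsum.tsum_eq_zero_add]
    simp only [psum, dser]
    simp
    congr 1; ext k; ring
  rw [e]; exact key

lemma HasSum.congr_fun' {f g : ℕ → ℂ} {l : ℂ} (h : ∀ k, g k = f k) (hf : HasSum f l) :
    HasSum g l := by
  rwa [funext h]

lemma psum_ode {u : ℕ → ℂ} (h : SubE u) {a b c : ℂ}
    (hrec : ∀ k : ℕ, (c + k) * (k + 1) * u (k + 1) = (a + k) * (b + k) * u k)
    {x : ℝ} (hx : |x| < 1) :
    (x : ℂ) * (1 - x) * psum (dser (dser u)) x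
      + (c - (a + b + 1) * x) * psum (dser u) x - a * b * psum u x = 0 := by
  have s0 := (h.summable' hx).hasSum
  have s1 := (h.dser.summable' hx).hasSum
  have s2 := (h.dser.dser.summable' hx).hasSum
  have t1 : HasSum (fun k : ℕ => (k : ℂ) * u k * (x : ℂ) ^ k) (x * psum (dser u) x) := by
    rw [← hasSum_nat_add_iff' 1]
    simp only [Finset.range_one, Finset.sum_singleton, Nat.cast_zero, zero_mul, sub_zero]
    have e := s1.mul_left (x : ℂ)
    refine HasSum.congr_fun' ?_ e
    intro k
    simp only [dser]; push_cast; ring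
  have t2 : HasSum (fun k : ℕ => (k : ℂ) * dser u k * (x : ℂ) ^ k)
      (x * psum (dser (dser u)) x) := by
    rw [← hasSum_nat_add_iff' 1]
    simp only [Finset.range_one, Finset.sum_singleton, Nat.cast_zero, zero_mul, sub_zero]
    have e := s2.mul_left (x : ℂ)
    refine HasSum.congr_fun' ?_ e
    intro k
    simp only [dser]; push_cast; ring
  have t3 : HasSum (fun k : ℕ => (k : ℂ) * (k - 1) * u k * (x : ℂ) ^ k)
      (x * (x * psum (dser (dser u)) x)) := by
    rw [← hasSum_nat_add_iff' 1]
    simp only [Finset.range_one, Finset.sum_singleton, Nat.cast_zero, zero_mul, sub_zero]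
    have e := t2.mul_left (x : ℂ)
    refine HasSum.congr_fun' ?_ e
    intro k
    simp only [dser]; push_cast; ring
  have tot := (((t2.sub t3).add (s1.mul_left c)).sub (t1.mul_left (a + b + 1))).sub
    (s0.mul_left (a * b))
  have z : HasSum (fun _ : ℕ => (0 : ℂ)) 0 := hasSum_zero
  have tot2 := HasSum.congr_fun' (g := fun _ => 0) (fun k => by
    have := hrec k
    simp only [dser]
    linear_combination (-(x : ℂ) ^ k) * this) tot
  have := tot2.unique z
  simp only [psum] at this ⊢
  linear_combination this

lemma abel_mul {u : ℕ → ℂ} (h : SubE u) {l : ℂ} (hl : Tendsto u atTop (𝓝 l)) :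
    Tendsto (fun x : ℝ => (1 - (x : ℂ)) * psum u x) (𝓝[<] 1) (𝓝 l) := by
  let f : ℕ → ℂ := fun n => Nat.casesOn n (u 0) (fun k => u (k + 1) - u k)
  have hf : ∀ n, ∑ i ∈ Finset.range (n + 1), f i = u n := by
    intro n
    induction n with
    | zero => simp [f]
    | succ k ih => rw [Finset.sum_range_succ, ih]; simp [f]
  have h1 : Tendsto (fun n => ∑ i ∈ Finset.range n, f i) atTop (𝓝 l) := by
    rw [← tendsto_add_atTop_iff_nat 1]
    simpa only [hf] using hl
  have h2 := Complex.tendsto_tsum_powerSeries_nhdsWithin_lt h1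
  rw [tendsto_map'_iff] at h2
  refine h2.congr' ?_
  filter_upwards [Ioo_mem_nhdsLT (show (0 : ℝ) < 1 by norm_num)] with x hx
  have hx1 : |x| < 1 := by rw [abs_of_pos hx.1]; exact hx.2
  have s0 := (h.summable' hx1).hasSum
  have s1 : HasSum (fun k : ℕ => f k * (x : ℂ) ^ k) ((1 - (x : ℂ)) * psum u x) := by
    rw [← hasSum_nat_add_iff' 1]
    have s3 := s0
    rw [← hasSum_nat_add_iff' 1] at s3
    convert s3.sub (s0.mul_left (x : ℂ)) using 1
    · ext k; simp [f]; ring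
    · simp [f, psum]; ring
  exact s1.tsum_eq

/-- hypergeometric coefficients -/
noncomputable def hco (a b c : ℂ) (k : ℕ) : ℂ :=
  (ascPochhammer ℂ k).eval a * (ascPochhammer ℂ k).eval b /
    ((ascPochhammer ℂ k).eval c * (Nat.factorial k : ℂ))

lemma hypF_eq (a b c : ℂ) : hypF a b c = psum (hco a b c) := rfl

lemma poch_ne {c : ℂ} (hc : 0 < c.re) (k : ℕ) : (ascPochhammer ℂ k).eval c ≠ 0 := by
  induction k with
  | zero => simp
  | succ k ih =>
    rw [ascPochhammer_succ_eval]
    refine mul_ne_zero ih (fun h => ?_)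
    have := congrArg Complex.re h
    simp at this
    have : (0 : ℝ) ≤ k := by positivity
    linarith

lemma hco_rec {a b c : ℂ} (hc : 0 < c.re) (k : ℕ) :
    (c + k) * (k + 1) * hco a b c (k + 1) = (a + k) * (b + k) * hco a b c k := by
  have h1 := poch_ne hc k
  have h2 := poch_ne hc (k + 1)
  rw [ascPochhammer_succ_eval] at h2
  have h3 := right_ne_zero_of_mul h2
  have h4 : ((k.factorial : ℕ) : ℂ) ≠ 0 := by exact_mod_cast k.factorial_ne_zero
  have h5 : (k : ℂ) + 1 ≠ 0 := by exact_mod_cast k.succ_ne_zero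
  simp only [hco, ascPochhammer_succ_eval, Nat.factorial_succ]
  push_cast
  field_simp

lemma ne_neg_nat {c : ℂ} (hc : 0 < c.re) (k : ℕ) : (k : ℂ) ≠ -c := by
  intro h
  have := congrArg Complex.re h
  simp at this
  have : (0 : ℝ) ≤ k := by positivity
  linarith

lemma hco_sub {a b c : ℂ} (ha : 0 < a.re) (hb : 0 < b.re) (hc : 0 < c.re) :
    SubE (hco a b c) := by
  intro r h0 h1
  have hr := ordinaryHypergeometricSeries_radius_eq_one (𝔸 := ℂ) a b c
    (fun k => ⟨ne_neg_nat ha k, ne_neg_nat hb k, ne_neg_nat hc k⟩)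
  obtain ⟨C, hC, h⟩ := (ordinaryHypergeometricSeries ℂ a b c).norm_mul_pow_le_of_lt_radius
    (r := ⟨r, h0.le⟩) (by rw [hr]; exact ENNReal.coe_lt_one_iff.2 (NNReal.coe_lt_one.1 h1))
  refine ⟨C, fun k => ?_⟩
  have := h k
  rw [ordinaryHypergeometricSeries, FormalMultilinearSeries.ofScalars_norm] at this
  refine le_trans (le_of_eq ?_) this
  congr 2
  simp only [hco, ordinaryHypergeometricCoefficient]
  field_simp

lemma poch_gamma {a : ℂ} {n : ℕ} :
    Complex.GammaSeq a n = (n : ℂ) ^ a * n.factorial / (ascPochhammer ℂ (n + 1)).eval a := by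
  have h : ∀ m : ℕ, (ascPochhammer ℂ m).eval a = ∏ j ∈ Finset.range m, (a + j) := by
    intro m
    induction m with
    | zero => simp
    | succ k ih => rw [ascPochhammer_succ_eval, ih, Finset.prod_range_succ]
  rw [Complex.GammaSeq, h]

lemma hco_lim {a b : ℂ} (ha : 0 < a.re) (hb : 0 < b.re) :
    Tendsto (dser (hco a b (a + b))) atTop
      (𝓝 (Complex.Gamma (a + b) / (Complex.Gamma a * Complex.Gamma b))) := by
  have hg := (Complex.GammaSeq_tendsto_Gamma (a + b)).div
    ((Complex.GammaSeq_tendsto_Gamma a).mul (Complex.GammaSeq_tendsto_Gamma b))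
    (mul_ne_zero (Complex.Gamma_ne_zero_of_re_pos ha) (Complex.Gamma_ne_zero_of_re_pos hb))
  refine hg.congr' ?_
  filter_upwards [eventually_gt_atTop 0] with n hn
  have hab : 0 < (a + b).re := by simp; linarith
  have h1 := poch_ne ha (n + 1)
  have h2 := poch_ne hb (n + 1)
  have h3 := poch_ne hab (n + 1)
  have hn0 : (n : ℂ) ≠ 0 := by exact_mod_cast hn.ne'
  have h4 : ((n.factorial : ℕ) : ℂ) ≠ 0 := by exact_mod_cast n.factorial_ne_zero
  have h5 : (n : ℂ) + 1 ≠ 0 := by exact_mod_cast n.succ_ne_zero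
  have h6 : (n : ℂ) ^ a ≠ 0 := by simp [Complex.cpow_eq_zero_iff, hn0]
  have h7 : (n : ℂ) ^ b ≠ 0 := by simp [Complex.cpow_eq_zero_iff, hn0]
  simp only [Pi.div_apply, poch_gamma, dser, hco, Nat.factorial_succ, Complex.cpow_add _ _ hn0]
  push_cast
  field_simp

lemma hco_lim0 {a b : ℂ} (ha : 0 < a.re) (hb : 0 < b.re) :
    Tendsto (hco a b (a + b)) atTop (𝓝 0) := by
  rw [← tendsto_add_atTop_iff_nat 1]
  have h := (hco_lim ha hb).mul (tendsto_one_div_add_atTop_nhds_zero_nat (𝕜 := ℂ))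
  rw [mul_zero] at h
  refine h.congr (fun n => ?_)
  have h5 : (n : ℂ) + 1 ≠ 0 := by exact_mod_cast n.succ_ne_zero
  simp only [dser]; field_simp

/-- The reduced Wronskian in the variable `x = 1/(1-t)`. -/
noncomputable def redW (α : ℂ) (u v : ℕ → ℂ) (x : ℝ) : ℂ :=
  (1 - (x : ℂ)) * ((1 - 2 * α) * psum u (1 - x) * psum v x
    + x * psum (dser u) (1 - x) * psum v x + x * psum u (1 - x) * psum (dser v) x)

lemma redW_deriv {α : ℂ} {u v : ℕ → ℂ} (hu : SubE u) (hv : SubE v)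
    (ru : ∀ k : ℕ, (1 + k) * (k + 1) * u (k + 1) = (α + k) * (α + k) * u k)
    (rv : ∀ k : ℕ, (2 - 2 * α + k) * (k + 1) * v (k + 1) = (1 - α + k) * (1 - α + k) * v k)
    {x : ℝ} (hx : x ∈ Set.Ioo (0 : ℝ) 1) : HasDerivAt (redW α u v) 0 x := by
  have hx1 : |x| < 1 := by rw [abs_of_pos hx.1]; exact hx.2
  have hy1 : |1 - x| < 1 := by rw [abs_lt]; constructor <;> linarith [hx.1, hx.2]
  have hs : HasDerivAt (fun x : ℝ => 1 - x) (-1) x := by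
    simpa using (hasDerivAt_id x).const_sub 1
  have hc : HasDerivAt (fun x : ℝ => (x : ℂ)) 1 x := (hasDerivAt_id (x : ℂ)).comp_ofReal
  have f0 := (psum_hasDerivAt hu hy1).scomp x hs
  have f1 := (psum_hasDerivAt hu.dser hy1).scomp x hs
  have g0 := psum_hasDerivAt hv hx1
  have g1 := psum_hasDerivAt hv.dser hx1
  have of := psum_ode hu (a := α) (b := α) (c := 1) ru hy1
  have og := psum_ode hv (a := 1 - α) (b := 1 - α) (c := 2 - 2 * α) rv hx1
  have tot := (hc.const_sub 1).mul ((((f0.const_mul (1 - 2 * α)).mul g0).add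
    ((hc.mul f1).mul g0)).add ((hc.mul f0).mul g1))
  refine tot.congr_deriv ?_
  simp only [Function.comp, Complex.real_smul, Pi.mul_apply, Pi.add_apply] at of og ⊢
  push_cast at of og ⊢
  linear_combination (-psum v x) * of + (psum u (1 - x)) * og

lemma redW_lim {α : ℂ} {u v : ℕ → ℂ} (hu : SubE u) (hv : SubE v) (hu0 : u 0 = 1) {l : ℂ}
    (v0 : Tendsto v atTop (𝓝 0)) (v1 : Tendsto (dser v) atTop (𝓝 l)) :
    Tendsto (redW α u v) (𝓝[<] 1) (𝓝 l) := by
  have A0 := abel_mul hv v0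
  have A1 := abel_mul hv.dser v1
  have hsub : Tendsto (fun x : ℝ => 1 - x) (𝓝[<] 1) (𝓝 0) := by
    refine tendsto_nhdsWithin_of_tendsto_nhds ?_
    have : Continuous (fun x : ℝ => 1 - x) := by fun_prop
    simpa using this.tendsto 1
  have hx : Tendsto (fun x : ℝ => (x : ℂ)) (𝓝[<] 1) (𝓝 1) := by
    refine tendsto_nhdsWithin_of_tendsto_nhds ?_
    simpa using Complex.continuous_ofReal.tendsto 1
  have z : |(0 : ℝ)| < 1 := by simp
  have F0 := (psum_hasDerivAt hu z).continuousAt.tendsto.comp hsub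
  have F1 := (psum_hasDerivAt hu.dser z).continuousAt.tendsto.comp hsub
  have e : psum u 0 = 1 := by
    rw [psum, tsum_eq_single 0]
    · simp [hu0]
    · intro k hk; simp [hk]
  rw [e] at F0
  have tot := (((F0.const_mul (1 - 2 * α)).mul A0).add ((hx.mul F1).mul A0)).add
    ((hx.mul F0).mul A1)
  simp only [mul_zero, one_mul, zero_add] at tot
  refine tot.congr (fun x => ?_)
  simp only [redW, Function.comp]
  ring

lemma redW_const {α : ℂ} {u v : ℕ → ℂ} (hu : SubE u) (hv : SubE v)
    (ru : ∀ k : ℕ, (1 + k) * (k + 1) * u (k + 1) = (α + k) * (α + k) * u k)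
    (rv : ∀ k : ℕ, (2 - 2 * α + k) * (k + 1) * v (k + 1) = (1 - α + k) * (1 - α + k) * v k)
    (hu0 : u 0 = 1) {l : ℂ}
    (v0 : Tendsto v atTop (𝓝 0)) (v1 : Tendsto (dser v) atTop (𝓝 l))
    {x : ℝ} (hx : x ∈ Set.Ioo (0 : ℝ) 1) : redW α u v x = l := by
  have hd : ∀ y ∈ Set.Ioo (0 : ℝ) 1, HasDerivAt (redW α u v) 0 y :=
    fun y hy => redW_deriv hu hv ru rv hy
  have hc : ∀ y ∈ Set.Ioo (0 : ℝ) 1, redW α u v y = redW α u v x := by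
    intro y hy
    refine isOpen_Ioo.is_const_of_deriv_eq_zero isPreconnected_Ioo
      (fun z hz => (hd z hz).differentiableAt.differentiableWithinAt)
      (fun z hz => (hd z hz).deriv) hy hx
  refine tendsto_nhds_unique ?_ (redW_lim hu hv hu0 v0 v1 (α := α))
  refine tendsto_const_nhds.congr' ?_
  filter_upwards [Ioo_mem_nhdsLT (show (0 : ℝ) < 1 by norm_num)] with y hy
  exact (hc y hy).symm

lemma cpow_deriv (β : ℂ) {t : ℝ} (ht : t < 0) :
    HasDerivAt (fun t : ℝ => ((1 - t : ℝ) : ℂ) ^ β)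
      (-(β * ((1 - t : ℝ) : ℂ) ^ β / ((1 - t : ℝ) : ℂ))) t := by
  have h1 : (0 : ℝ) < 1 - t := by linarith
  have hz : ((1 - t : ℝ) : ℂ) ≠ 0 := by exact_mod_cast h1.ne'
  have hs : HasDerivAt (fun t : ℝ => ((1 - t : ℝ) : ℂ)) (-1) t := by
    have : HasDerivAt (fun x : ℝ => 1 - x) (-1) t := by
      simpa using (hasDerivAt_id t).const_sub 1
    simpa using this.ofReal_comp
  have := (Complex.hasStrictDerivAt_cpow_const (c := β) (x := ((1 - t : ℝ) : ℂ))
    (Or.inl (by simpa using h1))).hasDerivAt.scomp t hs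
  refine this.congr_deriv ?_
  rw [Complex.cpow_sub _ _ hz, Complex.cpow_one, smul_eq_mul]
  ring

/-- for real s > 0 and α := 1/2 + i·s, with
w(t) := (1−t)^{−α}·F(α,α;1;t/(t−1)) and w⁺(t) := (1−t)^{α−1}·F(1−α,1−α;2−2α;1/(1−t)),
the reduced Wronskian t(1−t)(w'·w⁺ − w·(w⁺)') is constant on (−∞,0) and equals
Γ(2−2α)/Γ(1−α)². -/
theorem stmt_14 (s : ℝ) (hs : 0 < s) (α : ℂ) (hα : α = 1 / 2 + Complex.I * s)
    (w wp : ℝ → ℂ)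
    (hw : ∀ t : ℝ, w t = ((1 - t : ℝ) : ℂ) ^ (-α) * hypF α α 1 (t / (t - 1)))
    (hwp : ∀ t : ℝ, wp t =
      ((1 - t : ℝ) : ℂ) ^ (α - 1) * hypF (1 - α) (1 - α) (2 - 2 * α) (1 / (1 - t))) :
    ∀ t : ℝ, t < 0 →
      (t : ℂ) * (1 - (t : ℂ)) * (deriv w t * wp t - w t * deriv wp t)
        = Complex.Gamma (2 - 2 * α) / Complex.Gamma (1 - α) ^ 2 := by
  intro t ht
  have ra : 0 < α.re := by rw [hα]; simp
  have rb : 0 < (1 - α).re := by rw [hα]; simp; norm_num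
  have hab : 2 - 2 * α = (1 - α) + (1 - α) := by ring
  have rc : 0 < (2 - 2 * α).re := by rw [hab, Complex.add_re]; linarith
  have r1 : 0 < (1 : ℂ).re := by simp
  have h1 : (0 : ℝ) < 1 - t := by linarith
  have hxx : 1 / (1 - t) ∈ Set.Ioo (0 : ℝ) 1 :=
    ⟨by positivity, by rw [div_lt_one h1]; linarith⟩
  have hu := hco_sub ra ra r1
  have hv := hco_sub rb rb rc
  have v0 := hco_lim0 rb rb
  have v1 := hco_lim rb rb
  rw [← hab] at v0 v1
  have key := redW_const (α := α) hu hv (hco_rec r1) (hco_rec rc) (by simp [hco]) v0 v1 hxx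
  have hy : t / (t - 1) = 1 - 1 / (1 - t) := by
    have : t - 1 ≠ 0 := by linarith
    field_simp; ring
  have hx1 : |1 / (1 - t)| < 1 := by rw [abs_of_pos hxx.1]; exact hxx.2
  have hy1 : |t / (t - 1)| < 1 := by
    rw [hy, abs_lt]; constructor <;> linarith [hxx.1, hxx.2]
  have hz : (1 - (t : ℂ)) ≠ 0 := by exact_mod_cast h1.ne'
  have hz' : ((t : ℂ) - 1) ≠ 0 := by exact_mod_cast (by linarith : t - 1 ≠ 0)
  have dX : HasDerivAt (fun t : ℝ => 1 / (1 - t)) (1 / (1 - t) ^ 2) t := by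
    have := (((hasDerivAt_id t).const_sub 1).inv (by simpa using h1.ne'))
    have h2 : (fun t : ℝ => 1 / (1 - t)) = (fun x : ℝ => 1 - id x)⁻¹ := by
      ext y; simp
    rw [h2]
    exact this.congr_deriv (by simp)
  have dY : HasDerivAt (fun t : ℝ => t / (t - 1)) (-(1 / (1 - t) ^ 2)) t := by
    have := (hasDerivAt_id t).div ((hasDerivAt_id t).sub_const 1)
      (by simp; linarith)
    refine this.congr_deriv ?_
    have h3 : t - 1 ≠ 0 := by linarith
    have h4 := h1.ne'
    simp only [id]
    field_simp
    ring
  have dw := (cpow_deriv (-α) ht).mul ((psum_hasDerivAt hu hy1).scomp t dY)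
  have dwp := (cpow_deriv (α - 1) ht).mul ((psum_hasDerivAt hv hx1).scomp t dX)
  have ew : w = (fun t : ℝ => ((1 - t : ℝ) : ℂ) ^ (-α)) *
      psum (hco α α 1) ∘ fun t : ℝ => t / (t - 1) := funext hw
  have ewp : wp = (fun t : ℝ => ((1 - t : ℝ) : ℂ) ^ (α - 1)) *
      psum (hco (1 - α) (1 - α) (2 - 2 * α)) ∘ fun t : ℝ => 1 / (1 - t) := funext hwp
  have Ew := dw.deriv
  have Ewp := dwp.deriv
  rw [← ew] at Ew
  rw [← ewp] at Ewp
  rw [Ew, Ewp, hw, hwp, hypF_eq, hypF_eq, sq (Complex.Gamma (1 - α)), ← key, redW]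
  have hpow : ((1 - t : ℝ) : ℂ) ^ (-α) * ((1 - t : ℝ) : ℂ) ^ (α - 1) = 1 / (1 - (t : ℂ)) := by
    rw [← Complex.cpow_add _ _ (by exact_mod_cast h1.ne')]
    have : -α + (α - 1) = -1 := by ring
    rw [this, Complex.cpow_neg_one]; push_cast; simp
  simp only [Function.comp, Complex.real_smul]
  rw [hy]
  generalize psum (hco α α 1) (1 - 1 / (1 - t)) = f0
  generalize psum (dser (hco α α 1)) (1 - 1 / (1 - t)) = f1
  generalize psum (hco (1 - α) (1 - α) (2 - 2 * α)) (1 / (1 - t)) = g0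
  generalize psum (dser (hco (1 - α) (1 - α) (2 - 2 * α))) (1 / (1 - t)) = g1
  clear Ew Ewp dw dwp ew ewp hw hwp key
  generalize ((1 - t : ℝ) : ℂ) ^ (-α) = p at *
  generalize ((1 - t : ℝ) : ℂ) ^ (α - 1) = q at *
  have hq : p * q * (1 - (t : ℂ)) = 1 := by rw [hpow]; field_simp
  push_cast
  field_simp
  linear_combination ((t : ℂ) * (((1 - t) * α * f0 + -f1) * g0 -
    f0 * (-((1 - t) * g0 * (α - 1)) + g1))) * hq
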